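/- For every finite poset P, the unitary Tits form u_P is nonnegative definite if and only if it is weakly nonnegative definite. -/

import Mathlib

open scoped Classical

/-- The unitary Tits form `u_P` of a finite poset `P = {p_1, …, p_t}` whose strict order
is given by the relation `r` (with `r i j` meaning `p_{i+1} ≺ p_{j+1}`):
`u_P(x_0, x) = x_0² + 2(Σᵢ xᵢ² + Σ_{pᵢ≺pⱼ} xᵢxⱼ − x_0 Σᵢ xᵢ)`. -/
noncomputable def uForm (t : ℕ) (r : Fin t → Fin t → Prop) (x0 : ℤ) (x : Fin t → ℤ) : ℤ :=
  x0 ^ 2 + 2 * ((∑ i, x i ^ 2) + (∑ i, ∑ j, if r i j then x i * x j else 0)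
    - x0 * ∑ i, x i)

/-- Completing the square in `x0`. For an asymmetric relation, the remaining mixed term `xᵢxⱼ`
has coefficient `0` when `i`, `j` are comparable and `-1` otherwise. -/
theorem uForm_eq_sq_add (t : ℕ) (r : Fin t → Fin t → Prop) (x0 : ℤ) (x : Fin t → ℤ) :
    uForm t r x0 x = (x0 - ∑ i, x i) ^ 2 + 2 * (∑ i, x i ^ 2) +
      ∑ i, ∑ j, ((if r i j then 1 else 0) + (if r j i then 1 else 0) - 1) * (x i * x j) := by
  have hcomm : (∑ i, ∑ j, if r j i then x i * x j else 0) =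
      ∑ i, ∑ j, if r i j then x i * x j else 0 := by
    rw [Finset.sum_comm]
    simp only [mul_comm]
  have hsq : (∑ i, ∑ j, x i * x j) = (∑ i, x i) ^ 2 := by
    rw [sq, Finset.sum_mul_sum]
  have hsplit : (∑ i, ∑ j,
      ((if r i j then 1 else 0) + (if r j i then 1 else 0) - 1) * (x i * x j)) =
      2 * (∑ i, ∑ j, if r i j then x i * x j else 0) - (∑ i, x i) ^ 2 := by
    simp only [sub_mul, add_mul, ite_mul, one_mul, zero_mul, Finset.sum_sub_distrib,
      Finset.sum_add_distrib]
    rw [hcomm, hsq]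
    ring
  rw [hsplit, uForm]
  ring

/-- Passing to absolute values, with the optimal choice of `x0`, does not increase the form. -/
theorem uForm_abs_le (t : ℕ) (r : Fin t → Fin t → Prop)
    (hasymm : ∀ i j, r i j → ¬ r j i) (x0 : ℤ) (x : Fin t → ℤ) :
    uForm t r (∑ i, |x i|) (fun i => |x i|) ≤ uForm t r x0 x := by
  simp only [uForm_eq_sq_add, sq_abs, sub_self]
  gcongr ?_ + _ + ∑ i, ∑ j, ?_ with i _ j _
  · simpa using sq_nonneg (x0 - ∑ i, x i)
  · have hle : x i * x j ≤ |x i| * |x j| := abs_mul (x i) (x j) ▸ le_abs_self _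
    have := hasymm i j
    split_ifs <;> first | tauto | linarith

/-- For every finite poset `P` (elements enumerated so that `pᵢ ≺ pⱼ` implies `i < j`),
the unitary Tits form `u_P` is nonnegative definite if and only if it is weakly nonnegative
definite. -/
theorem uForm_nonnegative_definite_iff_weakly_nonnegative_definite
    (t : ℕ) (r : Fin t → Fin t → Prop)
    (htrans : ∀ i j k, r i j → r j k → r i k)
    (henum : ∀ i j, r i j → i < j) :
    (∀ (x0 : ℤ) (x : Fin t → ℤ), 0 ≤ uForm t r x0 x) ↔
      (∀ (x0 : ℤ) (x : Fin t → ℤ), 0 ≤ x0 → (∀ i, 0 ≤ x i) → 0 ≤ uForm t r x0 x) := by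
  refine ⟨fun h x0 x _ _ => h x0 x, fun h x0 x => ?_⟩
  have hasymm : ∀ i j, r i j → ¬ r j i := fun i j hij hji =>
    lt_asymm (henum i j hij) (henum j i hji)
  exact (h _ _ (Finset.sum_nonneg fun i _ => abs_nonneg (x i)) fun i => abs_nonneg (x i)).trans
    (uForm_abs_le t r hasymm x0 x)
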